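/- arXiv:1507.01075 — 2 statements merged into one kernel-verified Lean document; each statement's English description precedes it below -/
import Mathlib

section
/- Lower bound for the fractional dissipation term on a Littlewood–Paley shell: let 0 ≤ α ≤ 2 and 2 < l < ∞. There is a constant c > 0, depending only on α and l, such that for every L > 0, every λ ≥ 1/L, and every real-valued trigonometric polynomial u on 𝕋² = (ℝ/(Lℤ))² whose Fourier coefficients û(k) vanish unless λ ≤ 2π|k|/L ≤ 4λ, one has l ∫_{𝕋²} u(x) (Λ^α u)(x) |u(x)|^{l−2} dx ≥ c λ^α ∫_{𝕋²} |u(x)|^l dx. -/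
open MeasureTheory Complex Real
open scoped ENNReal

noncomputable section

/-- The exponential `e^{2πi k·x/L}` on the torus `𝕋² = (ℝ/(Lℤ))²`. -/
def torusChar (L : ℝ) (k : ℤ × ℤ) (x : AddCircle L × AddCircle L) : ℂ :=
  fourier k.1 x.1 * fourier k.2 x.2

/-- Euclidean norm of a lattice point `k ∈ ℤ²`. -/
def knorm (k : ℤ × ℤ) : ℝ := Real.sqrt ((k.1 : ℝ) ^ 2 + (k.2 : ℝ) ^ 2)

/-- The Fejér kernel, normalised to have total mass `2π` on a period. -/
def fejer (N : ℕ) (y : ℝ) : ℝ :=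
  (N : ℝ)⁻¹ * ‖∑ j ∈ Finset.range N, cexp (y * I) ^ j‖ ^ 2

lemma fejer_nonneg (N : ℕ) (y : ℝ) : 0 ≤ fejer N y := by
  unfold fejer; positivity

lemma continuous_fejer (N : ℕ) : Continuous (fejer N) := by
  unfold fejer; fun_prop

lemma fejer_le (N : ℕ) (hN : 0 < N) (y : ℝ) : fejer N y ≤ N := by
  have hN' : (0 : ℝ) < N := by exact_mod_cast hN
  have h : ‖∑ j ∈ Finset.range N, cexp (y * I) ^ j‖ ≤ N := by
    refine (norm_sum_le _ _).trans ?_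
    simp [Complex.norm_exp_ofReal_mul_I]
  calc fejer N y ≤ (N : ℝ)⁻¹ * (N : ℝ) ^ 2 := by unfold fejer; gcongr
    _ = N := by field_simp

lemma sq_mul_fejer_le (N : ℕ) {y : ℝ} (hy : |y| ≤ π) : y ^ 2 * fejer N y ≤ π ^ 2 / N := by
  have h1 : ‖cexp (y * I) - 1‖ * ‖∑ j ∈ Finset.range N, cexp (y * I) ^ j‖ ≤ 2 := by
    rw [← norm_mul, mul_geom_sum]
    refine (norm_sub_le _ _).trans ?_
    simp only [norm_pow, Complex.norm_exp_ofReal_mul_I, one_pow, norm_one]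
    norm_num
  have h2 : 2 / π * |y| ≤ ‖cexp (y * I) - 1‖ := by
    rw [mul_comm (y : ℂ) I, norm_exp_I_mul_ofReal_sub_one, norm_mul, Real.norm_eq_abs,
      Real.norm_eq_abs]
    have := Real.mul_abs_le_abs_sin (x := y / 2) (by rw [abs_div]; norm_num; linarith)
    rw [abs_div] at this
    norm_num at this ⊢
    rw [div_mul_eq_mul_div, mul_div_assoc]
    linarith
  have h3 : |y| * ‖∑ j ∈ Finset.range N, cexp (y * I) ^ j‖ ≤ π := by
    have := (mul_le_mul_of_nonneg_right h2 (norm_nonneg _)).trans h1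
    have hpi := Real.pi_pos
    rw [div_mul_eq_mul_div, div_mul_eq_mul_div, div_le_iff₀ hpi] at this
    linarith
  have h4 := pow_le_pow_left₀ (by positivity) h3 2
  rw [mul_pow, sq_abs] at h4
  unfold fejer
  calc _ = (y ^ 2 * ‖∑ j ∈ Finset.range N, cexp (y * I) ^ j‖ ^ 2) / N := by ring
    _ ≤ _ := by gcongr

lemma ofReal_fejer (N : ℕ) (y : ℝ) : (fejer N y : ℂ) =
    (N : ℂ)⁻¹ * ∑ j ∈ Finset.range N, ∑ m ∈ Finset.range N,
      cexp (((j : ℤ) - (m : ℤ) : ℤ) * I * y) := by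
  unfold fejer
  rw [← Complex.normSq_eq_norm_sq]
  push_cast
  rw [← Complex.mul_conj, map_sum, Finset.sum_mul_sum]
  congr 1
  refine Finset.sum_congr rfl fun j _ => Finset.sum_congr rfl fun m _ => ?_
  rw [map_pow, ← Complex.exp_conj, ← Complex.exp_nat_mul, ← Complex.exp_nat_mul, ← Complex.exp_add]
  congr 1
  simp
  ring

lemma integral_cexp_int (n : ℤ) :
    ∫ y in (-π)..π, cexp (n * I * (y : ℂ)) = if n = 0 then 2 * (π : ℂ) else 0 := by
  split_ifs with h
  · subst h; simp; ring
  · rw [integral_exp_mul_complex (mul_ne_zero (by exact_mod_cast h) I_ne_zero), div_eq_zero_iff]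
    left
    rw [sub_eq_zero, Complex.exp_eq_exp_iff_exists_int]
    exact ⟨n, by push_cast; ring⟩

lemma integral_fejer_mul_cexp (N : ℕ) (hN : 0 < N) (k : ℤ) (hk : k = 0 ∨ (N : ℤ) ≤ |k|) :
    ∫ y in (-π)..π, (fejer N y : ℂ) * cexp (k * I * (y : ℂ)) =
      if k = 0 then 2 * (π : ℂ) else 0 := by
  have h : ∀ y : ℝ, (fejer N y : ℂ) * cexp (k * I * (y : ℂ)) =
      (N : ℂ)⁻¹ * ∑ j ∈ Finset.range N, ∑ m ∈ Finset.range N,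
        cexp (((j : ℤ) - (m : ℤ) + k : ℤ) * I * y) := by
    intro y
    rw [ofReal_fejer, mul_assoc, Finset.sum_mul]
    simp_rw [Finset.sum_mul, ← Complex.exp_add]
    congr 1
    refine Finset.sum_congr rfl fun j _ => Finset.sum_congr rfl fun m _ => ?_
    congr 1
    push_cast
    ring
  simp_rw [h]
  rw [intervalIntegral.integral_const_mul, intervalIntegral.integral_finsetSum
    (fun j _ => Continuous.intervalIntegrable (by fun_prop) _ _)]
  have h2 : ∀ j ∈ Finset.range N, ∫ y in (-π)..π, ∑ m ∈ Finset.range N,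
      cexp (((j : ℤ) - (m : ℤ) + k : ℤ) * I * y) = if k = 0 then 2 * (π : ℂ) else 0 := by
    intro j hj
    rw [intervalIntegral.integral_finsetSum
      (fun j _ => Continuous.intervalIntegrable (by fun_prop) _ _)]
    simp_rw [integral_cexp_int]
    rcases hk with rfl | hk
    · simp only [add_zero, sub_eq_zero, Nat.cast_inj]
      rw [Finset.sum_ite_eq]
      simp [hj]
    · have hk0 : k ≠ 0 := by rintro rfl; simp at hk; omega
      rw [if_neg hk0]
      refine Finset.sum_eq_zero fun m hm => if_neg ?_
      rw [Finset.mem_range] at hj hm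
      intro h0
      rw [abs_eq_max_neg] at hk
      omega
  rw [Finset.sum_congr rfl h2]
  have : (N : ℂ) ≠ 0 := by exact_mod_cast hN.ne'
  simp [this]

lemma integral_fejer_mul_cos (N : ℕ) (hN : 0 < N) (k : ℤ) (hk : k = 0 ∨ (N : ℤ) ≤ |k|) :
    ∫ y in Set.Ioc (-π) π, fejer N y * Real.cos (k * y) = if k = 0 then 2 * π else 0 := by
  have h := congrArg Complex.re (integral_fejer_mul_cexp N hN k hk)
  rw [intervalIntegral.integral_of_le (by linarith [Real.pi_pos]), ← RCLike.re_eq_complex_re,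
    ← integral_re] at h
  · convert h using 1
    · refine integral_congr_ae (Filter.Eventually.of_forall fun y => ?_)
      simp only [RCLike.re_eq_complex_re, Complex.re_ofReal_mul]
      rw [show (k : ℂ) * I * y = ((k * y : ℝ) : ℂ) * I by push_cast; ring,
        Complex.exp_ofReal_mul_I_re]
    · split_ifs <;> simp
  · refine (Continuous.integrableOn_Icc ?_).mono_set Set.Ioc_subset_Icc_self
    have := continuous_fejer N
    fun_prop

lemma integral_fejer_mul_sin (N : ℕ) (hN : 0 < N) (k : ℤ) (hk : k = 0 ∨ (N : ℤ) ≤ |k|) :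
    ∫ y in Set.Ioc (-π) π, fejer N y * Real.sin (k * y) = 0 := by
  have h := congrArg Complex.im (integral_fejer_mul_cexp N hN k hk)
  rw [intervalIntegral.integral_of_le (by linarith [Real.pi_pos]), ← RCLike.im_eq_complex_im,
    ← integral_im] at h
  · convert h using 1
    · refine integral_congr_ae (Filter.Eventually.of_forall fun y => ?_)
      simp only [RCLike.im_eq_complex_im, Complex.im_ofReal_mul]
      rw [show (k : ℂ) * I * y = ((k * y : ℝ) : ℂ) * I by push_cast; ring,
        Complex.exp_ofReal_mul_I_im]
    · split_ifs <;> simp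
  · refine (Continuous.integrableOn_Icc ?_).mono_set Set.Ioc_subset_Icc_self
    have := continuous_fejer N
    fun_prop

lemma integral_fejer (N : ℕ) (hN : 0 < N) : ∫ y in Set.Ioc (-π) π, fejer N y = 2 * π := by
  simpa using integral_fejer_mul_cos N hN 0 (Or.inl rfl)

/-- The multiplier `1 - cos (k · y)` tested against the weights `q`, as a function of `y`. -/
def cosGap (S : Finset (ℤ × ℤ)) (q : ℤ × ℤ → ℝ) (y : ℝ × ℝ) : ℝ :=
  ∑ k ∈ S, q k * (1 - Real.cos (k.1 * y.1 + k.2 * y.2))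

lemma continuous_cosGap (S : Finset (ℤ × ℤ)) (q : ℤ × ℤ → ℝ) : Continuous (cosGap S q) := by
  unfold cosGap; fun_prop

/-- A multiple of the Cauchy density, which dominates the tail of `fejer N`. -/
def fejerTail (N : ℕ) (y : ℝ) : ℝ :=
  (N : ℝ) / (32 * π ^ 2) * (1 + ((N : ℝ) / (8 * π ^ 2) * y) ^ 2)⁻¹

lemma fejerTail_nonneg (N : ℕ) (y : ℝ) : 0 ≤ fejerTail N y := by
  unfold fejerTail; positivity

lemma integrable_fejerTail (N : ℕ) (hN : 0 < N) : Integrable (fejerTail N) := by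
  have hN' : (0 : ℝ) < N := by exact_mod_cast hN
  unfold fejerTail
  exact (integrable_inv_one_add_sq.comp_mul_left' (by positivity)).const_mul _

lemma integral_fejerTail (N : ℕ) (hN : 0 < N) : ∫ y, fejerTail N y = π / 4 := by
  have hN' : (0 : ℝ) < N := by exact_mod_cast hN
  unfold fejerTail
  rw [integral_const_mul,
    Measure.integral_comp_mul_left (fun y : ℝ => (1 + y ^ 2)⁻¹) ((N : ℝ) / (8 * π ^ 2)),
    integral_univ_inv_one_add_sq, abs_of_pos (by positivity), smul_eq_mul]
  field_simp
  norm_num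

lemma setIntegral_fejerTail_le (N : ℕ) (hN : 0 < N) :
    ∫ y in Set.Ioc (-π) π, fejerTail N y ≤ π / 4 := by
  rw [← integral_fejerTail N hN]
  exact setIntegral_le_integral (integrable_fejerTail N hN)
    (Filter.Eventually.of_forall (fejerTail_nonneg N))

lemma fejer_le_fejerTail (N : ℕ) (hN : 0 < N) {y : ℝ} (hy : |y| ≤ π)
    (hy' : 8 * π ^ 2 / N < |y|) : fejer N y ≤ fejerTail N y := by
  have hN' : (0 : ℝ) < N := by exact_mod_cast hN
  have hpi := Real.pi_pos
  have h1 := sq_mul_fejer_le N hy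
  have hy0 : 0 < |y| := lt_trans (by positivity) hy'
  have h2 : 1 < ((N : ℝ) / (8 * π ^ 2) * y) ^ 2 := by
    rw [← sq_abs, abs_mul, abs_of_pos (show 0 < (N : ℝ) / (8 * π ^ 2) by positivity)]
    refine one_lt_pow₀ ?_ two_ne_zero
    rw [div_lt_iff₀ hN'] at hy'
    rw [div_mul_eq_mul_div, one_lt_div (by positivity)]
    linarith
  have hy2 : 0 < y ^ 2 := by rw [← sq_abs]; positivity
  have h3 : fejer N y ≤ π ^ 2 / N / y ^ 2 := by
    rw [le_div_iff₀ hy2]; linarith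
  refine h3.trans ?_
  unfold fejerTail
  rw [← div_eq_mul_inv, le_div_iff₀ (by positivity)]
  calc π ^ 2 / N / y ^ 2 * (1 + ((N : ℝ) / (8 * π ^ 2) * y) ^ 2)
      ≤ π ^ 2 / N / y ^ 2 * (2 * ((N : ℝ) / (8 * π ^ 2) * y) ^ 2) := by gcongr; linarith
    _ = (N : ℝ) / (32 * π ^ 2) := by
      have : y ≠ 0 := by rintro rfl; simp at hy0
      field_simp
      norm_num

lemma Continuous.integrableOn_Ioc_prod {f : ℝ × ℝ → ℝ} (hf : Continuous f) {a b c d : ℝ} :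
    IntegrableOn f (Set.Ioc a b ×ˢ Set.Ioc c d) :=
  (hf.continuousOn.integrableOn_compact (isCompact_Icc.prod isCompact_Icc)).mono_set
    (Set.prod_mono Set.Ioc_subset_Icc_self Set.Ioc_subset_Icc_self)

lemma integral_fejer_mul_cos_add (N : ℕ) (hN : 0 < N) (k : ℤ × ℤ)
    (hk : (N : ℤ) ≤ |k.1| ∨ (N : ℤ) ≤ |k.2|) :
    ∫ y in Set.Ioc (-π) π ×ˢ Set.Ioc (-π) π,
      fejer N y.1 * fejer N y.2 * Real.cos (k.1 * y.1 + k.2 * y.2) = 0 := by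
  have hF := continuous_fejer N
  have h : ∀ y : ℝ × ℝ, fejer N y.1 * fejer N y.2 * Real.cos (k.1 * y.1 + k.2 * y.2) =
      (fejer N y.1 * Real.cos (k.1 * y.1)) * (fejer N y.2 * Real.cos (k.2 * y.2)) -
      (fejer N y.1 * Real.sin (k.1 * y.1)) * (fejer N y.2 * Real.sin (k.2 * y.2)) := by
    intro y
    rw [Real.cos_add]
    ring
  simp_rw [h]
  rw [integral_sub (Continuous.integrableOn_Ioc_prod (by fun_prop))
      (Continuous.integrableOn_Ioc_prod (by fun_prop)), Measure.volume_eq_prod,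
    setIntegral_prod_mul (fun t => fejer N t * Real.cos (k.1 * t))
      (fun t => fejer N t * Real.cos (k.2 * t)),
    setIntegral_prod_mul (fun t => fejer N t * Real.sin (k.1 * t))
      (fun t => fejer N t * Real.sin (k.2 * t))]
  have hne : ∀ m : ℤ, (N : ℤ) ≤ |m| → m ≠ 0 := by
    rintro _ h rfl
    simp at h
    omega
  rcases hk with hk | hk
  all_goals
    rw [integral_fejer_mul_sin N hN _ (Or.inr hk), integral_fejer_mul_cos N hN _ (Or.inr hk),
      if_neg (hne _ hk)]
    simp

lemma integral_cosGap_mul_fejer (S : Finset (ℤ × ℤ)) (q : ℤ × ℤ → ℝ) (N : ℕ) (hN : 0 < N)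
    (hq : ∀ k ∈ S, q k ≠ 0 → (N : ℤ) ≤ |k.1| ∨ (N : ℤ) ≤ |k.2|) :
    ∫ y in Set.Ioc (-π) π ×ˢ Set.Ioc (-π) π, cosGap S q y * (fejer N y.1 * fejer N y.2) =
      4 * π ^ 2 * ∑ k ∈ S, q k := by
  have hF := continuous_fejer N
  unfold cosGap
  simp_rw [Finset.sum_mul]
  rw [integral_finsetSum _ fun k _ => Continuous.integrableOn_Ioc_prod (by fun_prop),
    Finset.mul_sum]
  refine Finset.sum_congr rfl fun k hk => ?_
  by_cases hqk : q k = 0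
  · simp [hqk]
  have h : ∀ y : ℝ × ℝ, q k * (1 - Real.cos (k.1 * y.1 + k.2 * y.2)) *
      (fejer N y.1 * fejer N y.2) = q k * (fejer N y.1 * fejer N y.2 -
        fejer N y.1 * fejer N y.2 * Real.cos (k.1 * y.1 + k.2 * y.2)) := fun y => by ring
  simp_rw [h]
  rw [integral_const_mul, integral_sub (Continuous.integrableOn_Ioc_prod (by fun_prop))
      (Continuous.integrableOn_Ioc_prod (by fun_prop)),
    integral_fejer_mul_cos_add N hN k (hq k hk hqk), Measure.volume_eq_prod,
    setIntegral_prod_mul (fejer N) (fejer N), integral_fejer N hN]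
  ring

lemma integral_cosGap_box (S : Finset (ℤ × ℤ)) (q : ℤ × ℤ → ℝ) (N : ℕ) (hN : 0 < N)
    (hq : ∀ k ∈ S, q k ≠ 0 → (N : ℤ) ≤ |k.1| ∨ (N : ℤ) ≤ |k.2|)
    (h0 : ∀ y, 0 ≤ cosGap S q y) (h2 : ∀ y, cosGap S q y ≤ 2 * ∑ k ∈ S, q k) :
    2 * π ^ 2 * ∑ k ∈ S, q k ≤ (N : ℝ) ^ 2 * ∫ y in
      Set.Icc (-(8 * π ^ 2 / N)) (8 * π ^ 2 / N) ×ˢ Set.Icc (-(8 * π ^ 2 / N)) (8 * π ^ 2 / N),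
        cosGap S q y := by
  have hN' : (0 : ℝ) < N := by exact_mod_cast hN
  have hF := continuous_fejer N
  have hG := continuous_cosGap S q
  set A := ∑ k ∈ S, q k
  set B : Set (ℝ × ℝ) :=
    Set.Icc (-(8 * π ^ 2 / N)) (8 * π ^ 2 / N) ×ˢ Set.Icc (-(8 * π ^ 2 / N)) (8 * π ^ 2 / N)
    with hB
  set P : Set (ℝ × ℝ) := Set.Ioc (-π) π ×ˢ Set.Ioc (-π) π with hP
  have hBm : MeasurableSet B := measurableSet_Icc.prod measurableSet_Icc
  have hPm : MeasurableSet P := measurableSet_Ioc.prod measurableSet_Ioc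
  have hA : 0 ≤ A := by linarith [(h0 0).trans (h2 0)]
  have hBi : Integrable (B.indicator fun y => (N : ℝ) ^ 2 * cosGap S q y) :=
    (((continuous_const.mul hG).continuousOn.integrableOn_compact
      (isCompact_Icc.prod isCompact_Icc))).integrable_indicator hBm
  have hFi : IntegrableOn (fejer N) (Set.Ioc (-π) π) :=
    hF.integrableOn_Icc.mono_set Set.Ioc_subset_Icc_self
  have hTi : IntegrableOn (fejerTail N) (Set.Ioc (-π) π) := (integrable_fejerTail N hN).integrableOn
  have hTF : IntegrableOn (fun y : ℝ × ℝ => fejerTail N y.1 * fejer N y.2) P := by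
    rw [IntegrableOn, hP, Measure.volume_eq_prod, ← Measure.prod_restrict]
    exact hTi.mul_prod hFi
  have hFT : IntegrableOn (fun y : ℝ × ℝ => fejer N y.1 * fejerTail N y.2) P := by
    rw [IntegrableOn, hP, Measure.volume_eq_prod, ← Measure.prod_restrict]
    exact hFi.mul_prod hTi
  have key : ∀ y ∈ P, cosGap S q y * (fejer N y.1 * fejer N y.2) ≤
      B.indicator (fun y => (N : ℝ) ^ 2 * cosGap S q y) y +
        2 * A * (fejerTail N y.1 * fejer N y.2 + fejer N y.1 * fejerTail N y.2) := by
    intro y hy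
    have hy1 : |y.1| ≤ π := abs_le.mpr ⟨hy.1.1.le, hy.1.2⟩
    have hy2 : |y.2| ≤ π := abs_le.mpr ⟨hy.2.1.le, hy.2.2⟩
    have f1 := fejer_nonneg N y.1
    have f2 := fejer_nonneg N y.2
    have t1 := fejerTail_nonneg N y.1
    have t2 := fejerTail_nonneg N y.2
    have g0 := h0 y
    have g2 := h2 y
    by_cases hyB : y ∈ B
    · rw [Set.indicator_of_mem hyB]
      have hFF : fejer N y.1 * fejer N y.2 ≤ N * N :=
        mul_le_mul (fejer_le N hN _) (fejer_le N hN _) f2 hN'.le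
      have : 0 ≤ 2 * A * (fejerTail N y.1 * fejer N y.2 + fejer N y.1 * fejerTail N y.2) := by
        positivity
      nlinarith [mul_le_mul_of_nonneg_left hFF g0]
    · rw [Set.indicator_of_notMem hyB, zero_add]
      refine mul_le_mul g2 ?_ (by positivity) (by positivity)
      rw [hB, Set.mem_prod, not_and_or, Set.mem_Icc, Set.mem_Icc, ← abs_le, ← abs_le, not_le,
        not_le] at hyB
      rcases hyB with h | h
      · have := mul_le_mul_of_nonneg_right (fejer_le_fejerTail N hN hy1 h) f2
        have := mul_nonneg f1 t2
        linarith
      · have := mul_le_mul_of_nonneg_left (fejer_le_fejerTail N hN hy2 h) f1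
        have := mul_nonneg t1 f2
        linarith
  have hmono := setIntegral_mono_on (Continuous.integrableOn_Ioc_prod (by fun_prop))
    (hBi.integrableOn.add ((hTF.add hFT).const_mul (2 * A))) hPm key
  rw [integral_cosGap_mul_fejer S q N hN hq, integral_add' hBi.integrableOn
    ((hTF.add hFT).const_mul (2 * A)), integral_const_mul] at hmono
  simp only [Pi.add_apply] at hmono
  rw [integral_add hTF hFT, Measure.volume_eq_prod,
    setIntegral_prod_mul (fejerTail N) (fejer N), setIntegral_prod_mul (fejer N) (fejerTail N),
    ← Measure.volume_eq_prod, integral_fejer N hN] at hmono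
  have hle : ∫ y in P, B.indicator (fun y => (N : ℝ) ^ 2 * cosGap S q y) y ≤
      (N : ℝ) ^ 2 * ∫ y in B, cosGap S q y := by
    rw [← integral_const_mul, ← integral_indicator hBm]
    exact setIntegral_le_integral hBi (Filter.Eventually.of_forall
      (Set.indicator_nonneg fun y _ => mul_nonneg (by positivity) (h0 y)))
  have hT := mul_le_mul_of_nonneg_left (setIntegral_fejerTail_le N hN)
    (show 0 ≤ 8 * π * A by positivity)
  nlinarith [hT, hmono, hle]

/-- The density on `ℂ ≅ ℝ²` whose total integral normalises the singular-integral form of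
`|κ| ^ α`. -/
def rieszDensity (α : ℝ) (z : ℂ) : ℝ := (1 - Real.cos z.re) * ‖z‖ ^ (-2 - α)

lemma rieszDensity_nonneg (α : ℝ) (z : ℂ) : 0 ≤ rieszDensity α z :=
  mul_nonneg (by linarith [Real.cos_le_one z.re]) (Real.rpow_nonneg (norm_nonneg z) _)

lemma measurable_rieszDensity (α : ℝ) : Measurable (rieszDensity α) := by
  unfold rieszDensity
  fun_prop

lemma integrable_rieszDensity {α : ℝ} (h0 : 0 < α) (h2 : α < 2) : Integrable (rieszDensity α) := by
  have hdom : Integrable (fun z : ℂ => (fun r : ℝ => min 2 (r ^ 2) * r ^ (-2 - α)) ‖z‖) := by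
    rw [integrable_fun_norm_addHaar (μ := volume)
      (f := fun r : ℝ => min 2 (r ^ 2) * r ^ (-2 - α)), Complex.finrank_real_complex,
    ← Set.Ioc_union_Ioi_eq_Ioi (zero_le_one' ℝ)]
    refine IntegrableOn.union ?_ ?_
    · have h : IntegrableOn (fun r : ℝ => r ^ (1 - α)) (Set.Ioc 0 1) :=
        (intervalIntegrable_iff_integrableOn_Ioc_of_le zero_le_one).mp
          (intervalIntegral.intervalIntegrable_rpow' (by linarith))
      refine h.mono' (by fun_prop) ?_
      filter_upwards [ae_restrict_mem measurableSet_Ioc] with r hr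
      have hr0 : 0 < r := hr.1
      rw [Real.norm_of_nonneg (by positivity)]
      calc r ^ (2 - 1) • (min 2 (r ^ 2) * r ^ (-2 - α)) ≤ r ^ (2 - 1) • (r ^ 2 * r ^ (-2 - α)) := by
            gcongr; exact min_le_right _ _
        _ = r ^ (1 - α) := by
            rw [smul_eq_mul, ← mul_assoc, ← pow_add, ← Real.rpow_natCast, ← Real.rpow_add hr0]
            congr 1
            push_cast
            ring
    · have h : IntegrableOn (fun r : ℝ => 2 * r ^ (-1 - α)) (Set.Ioi 1) :=
        (integrableOn_Ioi_rpow_of_lt (by linarith) one_pos).const_mul 2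
      refine h.mono' (by fun_prop) ?_
      filter_upwards [ae_restrict_mem measurableSet_Ioi] with r hr
      have hr0 : 0 < r := lt_trans one_pos hr
      rw [Real.norm_of_nonneg (by positivity)]
      calc r ^ (2 - 1) • (min 2 (r ^ 2) * r ^ (-2 - α)) ≤ r ^ (2 - 1) • (2 * r ^ (-2 - α)) := by
            gcongr; exact min_le_left _ _
        _ = 2 * r ^ (-1 - α) := by
            rw [smul_eq_mul, mul_left_comm, ← Real.rpow_natCast, ← Real.rpow_add hr0]
            congr 2
            push_cast
            ring
  refine hdom.mono' (measurable_rieszDensity α).aestronglyMeasurable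
    (Filter.Eventually.of_forall fun z => ?_)
  rw [Real.norm_of_nonneg (rieszDensity_nonneg α z)]
  unfold rieszDensity
  refine mul_le_mul_of_nonneg_right (le_min ?_ ?_) (Real.rpow_nonneg (norm_nonneg z) _)
  · linarith [Real.neg_one_le_cos z.re]
  · have h1 : z.re ^ 2 ≤ ‖z‖ ^ 2 := by
      rw [← sq_abs]
      exact pow_le_pow_left₀ (abs_nonneg _) (Complex.abs_re_le_norm z) 2
    nlinarith [Real.one_sub_sq_div_two_le_cos (x := z.re), sq_nonneg z.re]

lemma integral_rieszDensity_pos {α : ℝ} (h0 : 0 < α) (h2 : α < 2) :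
    0 < ∫ z, rieszDensity α z := by
  rw [integral_pos_iff_support_of_nonneg (rieszDensity_nonneg α) (integrable_rieszDensity h0 h2)]
  refine lt_of_lt_of_le (Metric.measure_ball_pos volume (1 : ℂ) one_half_pos) (measure_mono ?_)
  intro z hz
  have h1 : |z.re - 1| < 1 / 2 := by
    refine lt_of_le_of_lt ?_ (mem_ball_iff_norm.mp hz)
    simpa using Complex.abs_re_le_norm (z - 1)
  rw [abs_lt] at h1
  have hz0 : z ≠ 0 := by
    rintro rfl
    simp at h1
    linarith [h1.1]
  have hcos : Real.cos z.re < 1 := by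
    have := Real.cos_lt_cos_of_nonneg_of_le_pi le_rfl
      (show z.re ≤ π by linarith [Real.pi_gt_three]) (by linarith [h1.1])
    simpa using this
  have := norm_pos_iff.mpr hz0
  refine (mul_pos (by linarith) (Real.rpow_pos_of_pos this _)).ne'

lemma integrable_and_integral_riesz {α : ℝ} (h0 : 0 < α) (h2 : α < 2) (κ : ℂ) :
    Integrable (fun z : ℂ => (1 - Real.cos (κ.re * z.re + κ.im * z.im)) * ‖z‖ ^ (-2 - α)) ∧
    ∫ z : ℂ, (1 - Real.cos (κ.re * z.re + κ.im * z.im)) * ‖z‖ ^ (-2 - α) =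
      ‖κ‖ ^ α * ∫ z, rieszDensity α z := by
  rcases eq_or_ne κ 0 with rfl | hκ
  · simp [Real.zero_rpow h0.ne']
  have hκn : 0 < ‖κ‖ := norm_pos_iff.mpr hκ
  let u : Circle := ⟨(starRingEnd ℂ) κ / ‖κ‖, by
    rw [Submonoid.unitSphere, Submonoid.mem_mk, Subsemigroup.mem_mk, mem_sphere_zero_iff_norm,
      norm_div, Complex.norm_conj, Complex.norm_real, norm_norm,
      div_self hκn.ne']⟩
  have hu : ∀ z : ℂ, ‖κ‖ • rotation u z = (starRingEnd ℂ) κ * z := by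
    intro z
    rw [rotation_apply, Complex.real_smul]
    have : (‖κ‖ : ℂ) ≠ 0 := by exact_mod_cast hκn.ne'
    change (‖κ‖ : ℂ) * ((starRingEnd ℂ) κ / ‖κ‖ * z) = _
    field_simp
  have hfun : (fun z : ℂ => (1 - Real.cos (κ.re * z.re + κ.im * z.im)) * ‖z‖ ^ (-2 - α)) =
      fun z => ‖κ‖ ^ (2 + α) * rieszDensity α (‖κ‖ • rotation u z) := by
    funext z
    rw [hu]
    unfold rieszDensity
    rw [norm_mul, Complex.norm_conj, Real.mul_rpow (norm_nonneg _) (norm_nonneg _),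
      show -2 - α = -(2 + α) by ring, Real.rpow_neg (norm_nonneg κ)]
    have : ‖κ‖ ^ (2 + α) ≠ 0 := (Real.rpow_pos_of_pos hκn _).ne'
    field_simp
    simp [mul_comm]
  have hmp := (rotation u).measurePreserving
  have hemb := (rotation u).toMeasurableEquiv.measurableEmbedding
  rw [hfun]
  constructor
  · refine Integrable.const_mul ?_ _
    exact hmp.integrable_comp_of_integrable ((integrable_rieszDensity h0 h2).comp_smul hκn.ne')
  · rw [integral_const_mul, hmp.integral_comp hemb (fun w => rieszDensity α (‖κ‖ • w)),
      Measure.integral_comp_smul, Complex.finrank_real_complex, abs_of_pos (by positivity),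
      smul_eq_mul, ← mul_assoc, Real.rpow_add hκn, Real.rpow_two]
    field_simp

lemma knorm_eq_norm (k : ℤ × ℤ) : knorm k = ‖(⟨k.1, k.2⟩ : ℂ)‖ := by
  rw [knorm, Complex.norm_def, Complex.normSq_mk, sq, sq]

lemma exists_le_sum_mul_knorm_rpow {α : ℝ} (h0 : 0 < α) (h2 : α < 2) :
    ∃ c : ℝ, 0 < c ∧ ∀ (S : Finset (ℤ × ℤ)) (q : ℤ × ℤ → ℝ) (N : ℕ), 0 < N →
      (∀ k ∈ S, q k ≠ 0 → (N : ℤ) ≤ |k.1| ∨ (N : ℤ) ≤ |k.2|) →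
      (∀ y, 0 ≤ cosGap S q y) → (∀ y, cosGap S q y ≤ 2 * ∑ k ∈ S, q k) →
      c * (N : ℝ) ^ α * ∑ k ∈ S, q k ≤ ∑ k ∈ S, q k * knorm k ^ α := by
  have hI := integral_rieszDensity_pos h0 h2
  set J := ∫ z, rieszDensity α z
  refine ⟨(16 * π ^ 2) ^ (-2 - α) * (2 * π ^ 2) / J, by positivity, fun S q N hN hq g0 g2 => ?_⟩
  have hN' : (0 : ℝ) < N := by exact_mod_cast hN
  have hbox := integral_cosGap_box S q N hN hq g0 g2
  set ρ : ℝ := 8 * π ^ 2 / N with hρ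
  set B : Set (ℝ × ℝ) := Set.Icc (-ρ) ρ ×ˢ Set.Icc (-ρ) ρ
  have hρ0 : 0 < ρ := by positivity
  have hcosGap : ∀ z : ℂ, cosGap S q (measurableEquivRealProd z) * ‖z‖ ^ (-2 - α) =
      ∑ k ∈ S, q k * ((1 - Real.cos ((⟨k.1, k.2⟩ : ℂ).re * z.re + (⟨k.1, k.2⟩ : ℂ).im * z.im)) *
        ‖z‖ ^ (-2 - α)) := by
    intro z
    simp only [cosGap, Finset.sum_mul, mul_assoc, measurableEquivRealProd_apply]
  have hint : Integrable (fun z : ℂ => cosGap S q (measurableEquivRealProd z) * ‖z‖ ^ (-2 - α)) := by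
    simp_rw [hcosGap]
    exact integrable_finsetSum _ fun k _ =>
      (integrable_and_integral_riesz h0 h2 ⟨k.1, k.2⟩).1.const_mul _
  have hval : ∫ z : ℂ, cosGap S q (measurableEquivRealProd z) * ‖z‖ ^ (-2 - α) =
      (∑ k ∈ S, q k * knorm k ^ α) * J := by
    simp_rw [hcosGap]
    rw [integral_finsetSum _ fun k _ =>
      (integrable_and_integral_riesz h0 h2 ⟨k.1, k.2⟩).1.const_mul _, Finset.sum_mul]
    refine Finset.sum_congr rfl fun k _ => ?_
    rw [integral_const_mul, (integrable_and_integral_riesz h0 h2 ⟨k.1, k.2⟩).2, knorm_eq_norm,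
      mul_assoc]
  have hBm : MeasurableSet (measurableEquivRealProd ⁻¹' B) :=
    measurableEquivRealProd.measurable (measurableSet_Icc.prod measurableSet_Icc)
  have hBi : IntegrableOn (fun z => cosGap S q (measurableEquivRealProd z))
      (measurableEquivRealProd ⁻¹' B) :=
    (volume_preserving_equiv_real_prod.integrableOn_comp_preimage
      measurableEquivRealProd.measurableEmbedding).mpr
      ((continuous_cosGap S q).continuousOn.integrableOn_compact (isCompact_Icc.prod isCompact_Icc))
  have hlow : (2 * ρ) ^ (-2 - α) * ∫ y in B, cosGap S q y ≤
      (∑ k ∈ S, q k * knorm k ^ α) * J := by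
    rw [← hval, ← volume_preserving_equiv_real_prod.setIntegral_preimage_emb
      measurableEquivRealProd.measurableEmbedding, ← integral_const_mul]
    refine (setIntegral_mono_on (hBi.const_mul _) hint.integrableOn hBm fun z hz => ?_).trans
      (setIntegral_le_integral hint (Filter.Eventually.of_forall fun z =>
        mul_nonneg (g0 _) (Real.rpow_nonneg (norm_nonneg _) _)))
    rcases eq_or_ne z 0 with rfl | hz0
    · simp [cosGap]
    rw [mul_comm]
    refine mul_le_mul_of_nonneg_left ?_ (g0 _)
    refine Real.rpow_le_rpow_of_nonpos (norm_pos_iff.mpr hz0) ?_ (by linarith)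
    have h1 : |z.re| ≤ ρ := abs_le.mpr hz.1
    have h2 : |z.im| ≤ ρ := abs_le.mpr hz.2
    linarith [Complex.norm_le_abs_re_add_abs_im z]
  have hpow : (2 * ρ) ^ (-2 - α) = (16 * π ^ 2) ^ (-2 - α) * ((N : ℝ) ^ 2 * (N : ℝ) ^ α) := by
    rw [hρ, show 2 * (8 * π ^ 2 / N) = (16 * π ^ 2) * (N : ℝ)⁻¹ by ring,
      Real.mul_rpow (by positivity) (by positivity), Real.inv_rpow hN'.le, ← Real.rpow_neg hN'.le,
      ← Real.rpow_two (N : ℝ), ← Real.rpow_add hN']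
    congr 2
    ring
  rw [hpow] at hlow
  have h3 := mul_le_mul_of_nonneg_left hbox
    (show 0 ≤ (16 * π ^ 2) ^ (-2 - α) * (N : ℝ) ^ α by positivity)
  rw [div_mul_eq_mul_div, div_mul_eq_mul_div, div_le_iff₀ hI]
  linarith

lemma cosGap_le_of_doubling (S : Finset (ℤ × ℤ)) (q : ℤ × ℤ → ℝ) {C : ℝ}
    (hC : ∀ (n : ℕ) (y : ℝ × ℝ), cosGap S q (n • y) ≤ C * (n : ℝ) ^ 2 * cosGap S q y)
    (y : ℝ × ℝ) : cosGap S q y ≤ C / 2 * ∑ k ∈ S, q k * (k.1 * y.1 + k.2 * y.2) ^ 2 := by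
  have hcos : ∀ t : ℝ, 1 - Real.cos t = t ^ 2 * Real.sinc (t / 2) ^ 2 / 2 := by
    intro t
    rcases eq_or_ne t 0 with rfl | ht
    · simp
    rw [Real.sinc_of_ne_zero (by simpa using ht)]
    have h := Real.cos_sq' (t / 2)
    rw [Real.cos_sq, show 2 * (t / 2) = t by ring] at h
    field_simp
    linarith
  have hle : ∀ᶠ n : ℕ in Filter.atTop, cosGap S q y ≤ C / 2 * ∑ k ∈ S,
      q k * ((k.1 * y.1 + k.2 * y.2) ^ 2 *
        Real.sinc ((k.1 * y.1 + k.2 * y.2) / 2 * (n : ℝ)⁻¹) ^ 2) := by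
    filter_upwards [Filter.eventually_gt_atTop 0] with n hn
    have hn' : (n : ℝ) ≠ 0 := by exact_mod_cast hn.ne'
    have h := hC n ((n : ℝ)⁻¹ • y)
    rw [← Nat.cast_smul_eq_nsmul ℝ, smul_smul, mul_inv_cancel₀ hn', one_smul] at h
    refine h.trans (le_of_eq ?_)
    unfold cosGap
    rw [Finset.mul_sum, Finset.mul_sum]
    refine Finset.sum_congr rfl fun k _ => ?_
    rw [hcos, Prod.smul_fst, Prod.smul_snd, smul_eq_mul, smul_eq_mul,
      show (k.1 * ((n : ℝ)⁻¹ * y.1) + k.2 * ((n : ℝ)⁻¹ * y.2)) =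
        (k.1 * y.1 + k.2 * y.2) * (n : ℝ)⁻¹ by ring, div_mul_eq_mul_div _ (2 : ℝ) (n : ℝ)⁻¹]
    field_simp
  refine ge_of_tendsto ?_ hle
  refine Filter.Tendsto.const_mul _ (tendsto_finsetSum _ fun k _ => Filter.Tendsto.const_mul _ ?_)
  have h1 : Filter.Tendsto (fun n : ℕ => (k.1 * y.1 + k.2 * y.2) / 2 * (n : ℝ)⁻¹) Filter.atTop
      (nhds 0) := by
    simpa using (tendsto_inv_atTop_nhds_zero_nat (𝕜 := ℝ)).const_mul ((k.1 * y.1 + k.2 * y.2) / 2)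
  have h2 := ((Real.continuous_sinc.tendsto 0).comp h1).pow 2
  simpa using h2.const_mul ((k.1 * y.1 + k.2 * y.2) ^ 2)

lemma exists_le_sum_mul_knorm_sq {C : ℝ} (hC : 0 < C) :
    ∃ c : ℝ, 0 < c ∧ ∀ (S : Finset (ℤ × ℤ)) (q : ℤ × ℤ → ℝ) (N : ℕ), 0 < N →
      (∀ k ∈ S, q k ≠ 0 → (N : ℤ) ≤ |k.1| ∨ (N : ℤ) ≤ |k.2|) →
      (∀ y, 0 ≤ cosGap S q y) → (∀ y, cosGap S q y ≤ 2 * ∑ k ∈ S, q k) →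
      (∀ (n : ℕ) (y : ℝ × ℝ), cosGap S q (n • y) ≤ C * (n : ℝ) ^ 2 * cosGap S q y) →
      c * (N : ℝ) ^ 2 * ∑ k ∈ S, q k ≤ ∑ k ∈ S, q k * knorm k ^ 2 := by
  refine ⟨2 * π ^ 2 / (4 * C * (8 * π ^ 2) ^ 4), by positivity, fun S q N hN hq g0 g2 g3 => ?_⟩
  have hN' : (0 : ℝ) < N := by exact_mod_cast hN
  have hbox := integral_cosGap_box S q N hN hq g0 g2
  set ρ : ℝ := 8 * π ^ 2 / N with hρ
  set B : Set (ℝ × ℝ) := Set.Icc (-ρ) ρ ×ˢ Set.Icc (-ρ) ρ with hB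
  have hρ0 : 0 < ρ := by positivity
  have hBm : MeasurableSet B := measurableSet_Icc.prod measurableSet_Icc
  have hBc : IsCompact B := isCompact_Icc.prod isCompact_Icc
  set Q := ∑ k ∈ S, q k * knorm k ^ 2
  have hquad : ∀ y : ℝ × ℝ, cosGap S q y ≤ C / 2 * (y.1 ^ 2 + y.2 ^ 2) * Q := by
    intro y
    have h1 := cosGap_le_of_doubling S q g3 y
    have h2 := (g0 _).trans (cosGap_le_of_doubling S q g3 (-y.2, y.1))
    have h3 : C / 2 * (y.1 ^ 2 + y.2 ^ 2) * Q =
        C / 2 * ∑ k ∈ S, q k * (k.1 * y.1 + k.2 * y.2) ^ 2 +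
        C / 2 * ∑ k ∈ S, q k * (k.1 * (-y.2) + k.2 * y.1) ^ 2 := by
      rw [mul_assoc, ← mul_add, ← Finset.sum_add_distrib, Finset.mul_sum]
      congr 1
      refine Finset.sum_congr rfl fun k _ => ?_
      rw [knorm, Real.sq_sqrt (by positivity)]
      ring
    linarith
  have hQ : 0 ≤ Q := by
    have := (g0 (1, 0)).trans (hquad (1, 0))
    norm_num at this
    exact nonneg_of_mul_nonneg_right this (by positivity)
  have hup : ∫ y in B, cosGap S q y ≤ 4 * C * ρ ^ 4 * Q := by
    have h1 : ∀ y ∈ B, cosGap S q y ≤ C * ρ ^ 2 * Q := by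
      intro y hy
      have hy1 : y.1 ^ 2 ≤ ρ ^ 2 := sq_le_sq' hy.1.1 hy.1.2
      have hy2 : y.2 ^ 2 ≤ ρ ^ 2 := sq_le_sq' hy.2.1 hy.2.2
      calc cosGap S q y ≤ C / 2 * (y.1 ^ 2 + y.2 ^ 2) * Q := hquad y
        _ ≤ C / 2 * (ρ ^ 2 + ρ ^ 2) * Q := by gcongr
        _ = C * ρ ^ 2 * Q := by ring
    have h2 := setIntegral_mono_on ((continuous_cosGap S q).continuousOn.integrableOn_compact hBc)
      (integrableOn_const (hBc.measure_lt_top (μ := volume)).ne) hBm h1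
    refine h2.trans (le_of_eq ?_)
    rw [setIntegral_const, hB, measureReal_def, Measure.volume_eq_prod, Measure.prod_prod,
      Real.volume_Icc, ENNReal.toReal_mul, ENNReal.toReal_ofReal (by linarith), smul_eq_mul]
    ring
  have h3 : 2 * π ^ 2 * ∑ k ∈ S, q k ≤ (N : ℝ) ^ 2 * (4 * C * ρ ^ 4 * Q) :=
    hbox.trans (by gcongr)
  rw [div_mul_eq_mul_div, div_mul_eq_mul_div, div_le_iff₀ (by positivity)]
  have h4 := mul_le_mul_of_nonneg_right h3 (show 0 ≤ (N : ℝ) ^ 2 by positivity)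
  have h5 : (N : ℝ) ^ 2 * (4 * C * ρ ^ 4 * Q) * (N : ℝ) ^ 2 = Q * (4 * C * (8 * π ^ 2) ^ 4) := by
    rw [hρ]
    field_simp
  linarith

/-- The odd power function `a ↦ a |a| ^ r`. -/
def oddPow (r a : ℝ) : ℝ := a * |a| ^ r

lemma oddPow_neg (r a : ℝ) : oddPow r (-a) = -oddPow r a := by
  simp [oddPow]

lemma continuous_oddPow {r : ℝ} (hr : 0 ≤ r) : Continuous (oddPow r) :=
  continuous_id.mul (continuous_abs.rpow_const fun _ => Or.inr hr)

lemma le_two_mul_oddPow_sub {r a b : ℝ} (hr : 0 ≤ r) (ha : 0 ≤ a) (hb : |b| ≤ a) :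
    a ^ r * (a - b) ≤ 2 * (oddPow r a - oddPow r b) := by
  have hpow : |b| ^ r ≤ a ^ r := Real.rpow_le_rpow (abs_nonneg b) hb hr
  have hb0 : 0 ≤ |b| ^ r := Real.rpow_nonneg (abs_nonneg b) r
  have ha0 : 0 ≤ a ^ r := Real.rpow_nonneg ha r
  rw [abs_le] at hb
  unfold oddPow
  rw [abs_of_nonneg ha]
  rcases le_total 0 b with h | h
  · nlinarith [mul_le_mul_of_nonneg_left hpow h, mul_nonneg ha0 (sub_nonneg.mpr hb.2)]
  · nlinarith [mul_nonneg (neg_nonneg.mpr h) hb0, mul_nonneg ha0 (show 0 ≤ a + b by linarith)]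

lemma oddPow_sub_le {r a b : ℝ} (hr : 0 ≤ r) (ha : 0 ≤ a) (hb : |b| ≤ a) :
    oddPow r a - oddPow r b ≤ (r + 1) * (a ^ r * (a - b)) := by
  have hpow : |b| ^ r ≤ a ^ r := Real.rpow_le_rpow (abs_nonneg b) hb hr
  have ha0 : 0 ≤ a ^ r := Real.rpow_nonneg ha r
  have hb' := abs_le.mp hb
  have hd : 0 ≤ a ^ r * (a - b) := mul_nonneg ha0 (sub_nonneg.mpr hb'.2)
  unfold oddPow
  rw [abs_of_nonneg ha]
  rcases le_total 0 b with h | h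
  · rw [abs_of_nonneg h]
    rcases ha.eq_or_lt with rfl | hapos
    · obtain rfl : b = 0 := by linarith [hb'.2]
      simp
    have hB := one_add_mul_self_le_rpow_one_add (s := b / a - 1) (p := r + 1)
      (by have : 0 ≤ b / a := by positivity
          linarith) (by linarith)
    rw [add_sub_cancel, Real.div_rpow h ha, le_div_iff₀ (by positivity),
      Real.rpow_add_one' h (by linarith), Real.rpow_add_one hapos.ne'] at hB
    have : (1 + (r + 1) * (b / a - 1)) * (a ^ r * a) = a ^ r * (a + (r + 1) * (b - a)) := by
      field_simp
    rw [this] at hB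
    linarith
  · nlinarith [mul_le_mul_of_nonneg_left hpow (neg_nonneg.mpr h), mul_nonneg hr hd]

lemma oddPow_sub_mul_sub {r : ℝ} (hr : 0 ≤ r) (a b : ℝ) :
    0 ≤ (oddPow r a - oddPow r b) * (a - b) ∧
    (oddPow r a - oddPow r b) * (a - b) ≤
      4 * (r + 1) * (oddPow (r / 2) a - oddPow (r / 2) b) ^ 2 ∧
    (oddPow (r / 2) a - oddPow (r / 2) b) ^ 2 ≤
      2 * (r / 2 + 1) ^ 2 * ((oddPow r a - oddPow r b) * (a - b)) := by
  wlog hab : |b| ≤ |a| generalizing a b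
  · have h := this b a (le_of_not_ge hab)
    rw [← neg_sub (oddPow r a), ← neg_sub a b, neg_mul_neg, ← neg_sub (oddPow (r / 2) a),
      neg_sq] at h
    exact h
  wlog ha : 0 ≤ a generalizing a b
  · have h := this (-a) (-b) (by simpa using hab) (by linarith)
    simp only [oddPow_neg] at h
    rw [show -oddPow r a - -oddPow r b = -(oddPow r a - oddPow r b) by ring,
      show -a - -b = -(a - b) by ring, neg_mul_neg,
      show -oddPow (r / 2) a - -oddPow (r / 2) b = -(oddPow (r / 2) a - oddPow (r / 2) b) by ring,
      neg_sq] at h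
    exact h
  rw [abs_of_nonneg ha] at hab
  have hs : 0 ≤ r / 2 := by linarith
  have hd : 0 ≤ a - b := by linarith [(abs_le.mp hab).2]
  have l1 := le_two_mul_oddPow_sub hr ha hab
  have l2 := le_two_mul_oddPow_sub hs ha hab
  have u1 := oddPow_sub_le hr ha hab
  have u2 := oddPow_sub_le hs ha hab
  have hsq : a ^ r = (a ^ (r / 2)) ^ 2 := by
    rw [← Real.rpow_natCast, ← Real.rpow_mul ha]
    congr 1
    push_cast
    ring
  have hm : 0 ≤ a ^ (r / 2) * (a - b) := mul_nonneg (Real.rpow_nonneg ha _) hd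
  set m := a ^ (r / 2) * (a - b)
  have hX : a ^ r * (a - b) * (a - b) = m ^ 2 := by rw [hsq]; ring
  have l1' := mul_le_mul_of_nonneg_right l1 hd
  have u1' := mul_le_mul_of_nonneg_right u1 hd
  have l2' := pow_le_pow_left₀ hm l2 2
  have u2' := pow_le_pow_left₀ (show 0 ≤ oddPow (r / 2) a - oddPow (r / 2) b by linarith) u2 2
  rw [hX] at l1'
  rw [mul_assoc, hX] at u1'
  rw [mul_pow] at l2' u2'
  refine ⟨by nlinarith [sq_nonneg m], ?_, ?_⟩
  · nlinarith [mul_le_mul_of_nonneg_left l2' (show 0 ≤ r + 1 by linarith)]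
  · nlinarith [mul_le_mul_of_nonneg_left l1' (sq_nonneg (r / 2 + 1))]

lemma integral_sub_translate_nsmul_sq_le {T : Type*} [AddCommGroup T] [TopologicalSpace T]
    [CompactSpace T] [MeasurableSpace T] [BorelSpace T] [IsTopologicalAddGroup T] (μ : Measure T)
    [IsFiniteMeasure μ] [μ.IsAddRightInvariant] {w : T → ℝ} (hw : Continuous w) (t : T) (n : ℕ) :
    ∫ x, (w (x + n • t) - w x) ^ 2 ∂μ ≤ (n : ℝ) ^ 2 * ∫ x, (w (x + t) - w x) ^ 2 ∂μ := by
  have hint : ∀ {f : T → ℝ}, Continuous f → Integrable f μ := fun hf =>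
    hf.integrable_of_hasCompactSupport (HasCompactSupport.of_compactSpace _)
  have h1 : ∀ x, (w (x + n • t) - w x) ^ 2 ≤
      n * ∑ j ∈ Finset.range n, (w (x + j • t + t) - w (x + j • t)) ^ 2 := by
    intro x
    have h := Finset.sum_range_sub (fun j : ℕ => w (x + j • t)) n
    simp only [zero_smul, add_zero, succ_nsmul, ← add_assoc] at h
    rw [← h]
    simpa using sq_sum_le_card_mul_sum_sq (s := Finset.range n)
      (f := fun j => w (x + j • t + t) - w (x + j • t))
  refine (integral_mono (hint (by fun_prop)) (hint (by fun_prop)) h1).trans (le_of_eq ?_)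
  rw [integral_const_mul, integral_finsetSum _ fun j _ => hint (by fun_prop)]
  have h2 : ∀ j ∈ Finset.range n, ∫ x, (w (x + j • t + t) - w (x + j • t)) ^ 2 ∂μ =
      ∫ x, (w (x + t) - w x) ^ 2 ∂μ := fun j _ =>
    integral_add_right_eq_self (fun x => (w (x + t) - w x) ^ 2) (j • t)
  rw [Finset.sum_congr rfl h2]
  simp
  ring

lemma integral_oddPow_symmetrize {T : Type*} [AddCommGroup T] [TopologicalSpace T]
    [CompactSpace T] [MeasurableSpace T] [BorelSpace T] [IsTopologicalAddGroup T] (μ : Measure T)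
    [IsFiniteMeasure μ] [μ.IsAddRightInvariant] {r : ℝ} (hr : 0 ≤ r) {u : T → ℝ}
    (hu : Continuous u) (t : T) (s : ℝ) (hs : s ^ 2 = 1) :
    ∫ x, (oddPow r (u (x + t)) - s * oddPow r (u x)) * (u (x + t) - s * u x) ∂μ =
      2 * (∫ x, oddPow r (u x) * u x ∂μ) -
        s * ∫ x, oddPow r (u x) * (u (x + t) + u (x - t)) ∂μ := by
  have hint : ∀ {f : T → ℝ}, Continuous f → Integrable f μ := fun hf =>
    hf.integrable_of_hasCompactSupport (HasCompactSupport.of_compactSpace _)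
  have hφ := continuous_oddPow hr
  have e1 := integral_add_right_eq_self (μ := μ) (fun x => oddPow r (u x) * u x) t
  have e2 := integral_add_right_eq_self (μ := μ) (fun x => oddPow r (u x) * u (x - t)) t
  simp only [add_sub_cancel_right] at e2
  have h : ∀ x, (oddPow r (u (x + t)) - s * oddPow r (u x)) * (u (x + t) - s * u x) =
      (oddPow r (u (x + t)) * u (x + t) + oddPow r (u x) * u x) -
        s * (oddPow r (u (x + t)) * u x + oddPow r (u x) * u (x + t)) := by
    intro x
    linear_combination (oddPow r (u x) * u x) * hs
  simp_rw [h, mul_add]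
  rw [integral_sub (hint (by fun_prop)) (hint (by fun_prop)),
    integral_add (hint (by fun_prop)) (hint (by fun_prop)),
    integral_add (hint (by fun_prop)) (hint (by fun_prop)), integral_const_mul, integral_const_mul,
    integral_add (hint (by fun_prop)) (hint (by fun_prop)), e1, e2]
  ring

/-- The translation of the torus on which `torusChar L k` takes the value `e^{i k·y}`. -/
def torusShift (L : ℝ) (y : ℝ × ℝ) : AddCircle L × AddCircle L :=
  (((L / (2 * π) * y.1 : ℝ) : AddCircle L), ((L / (2 * π) * y.2 : ℝ) : AddCircle L))

lemma torusShift_nsmul (L : ℝ) (n : ℕ) (y : ℝ × ℝ) :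
    torusShift L (n • y) = n • torusShift L y := by
  unfold torusShift
  ext <;> simp only [Prod.smul_fst, Prod.smul_snd, ← AddCircle.coe_nsmul] <;>
    simp only [nsmul_eq_mul, mul_left_comm]

lemma torusShift_neg (L : ℝ) (y : ℝ × ℝ) : torusShift L (-y) = -torusShift L y := by
  unfold torusShift
  ext <;> simp

lemma continuous_torusChar (L : ℝ) (k : ℤ × ℤ) : Continuous (torusChar L k) := by
  unfold torusChar
  fun_prop

lemma torusChar_add (L : ℝ) (k : ℤ × ℤ) (x t : AddCircle L × AddCircle L) :
    torusChar L k (x + t) = torusChar L k x * torusChar L k t := by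
  simp only [torusChar, fourier_apply, Prod.fst_add, Prod.snd_add, smul_add,
    AddCircle.toCircle_add, Circle.coe_mul]
  ring

lemma torusChar_torusShift {L : ℝ} (hL : 0 < L) (k : ℤ × ℤ) (y : ℝ × ℝ) :
    torusChar L k (torusShift L y) = cexp ((k.1 * y.1 + k.2 * y.2 : ℝ) * I) := by
  have hL' : (L : ℂ) ≠ 0 := by exact_mod_cast hL.ne'
  have hpi : (π : ℂ) ≠ 0 := by exact_mod_cast Real.pi_ne_zero
  rw [torusChar, torusShift, fourier_coe_apply, fourier_coe_apply, ← Complex.exp_add]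
  congr 1
  push_cast
  field_simp

lemma re_mul_torusChar_add_add_sub {L : ℝ} (hL : 0 < L) (a : ℂ) (k : ℤ × ℤ)
    (x : AddCircle L × AddCircle L) (y : ℝ × ℝ) :
    (a * torusChar L k (x + torusShift L y)).re + (a * torusChar L k (x - torusShift L y)).re =
      2 * Real.cos (k.1 * y.1 + k.2 * y.2) * (a * torusChar L k x).re := by
  rw [sub_eq_add_neg, ← torusShift_neg, torusChar_add, torusChar_add, torusChar_torusShift hL,
    torusChar_torusShift hL, ← Complex.add_re, ← mul_assoc, ← mul_assoc, ← mul_add,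
    ← Complex.re_ofReal_mul]
  congr 1
  rw [mul_comm, Complex.ofReal_mul, Complex.ofReal_cos, Complex.cos, Prod.fst_neg, Prod.snd_neg]
  push_cast
  ring_nf

instance {L : ℝ} [Fact (0 < L)] :
    (volume : Measure (AddCircle L × AddCircle L)).IsAddRightInvariant := by
  have : (volume : Measure (AddCircle L × AddCircle L)).IsAddLeftInvariant :=
    inferInstanceAs ((volume : Measure (AddCircle L)).prod volume).IsAddLeftInvariant
  infer_instance

/-- The coefficients `∫ u |u| ^ r Re (co_k e_k)` of the duality pairing of `u = Re ∑ co_k e_k`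
with its Fourier modes. -/
def dualCoeff (L : ℝ) [Fact (0 < L)] (S : Finset (ℤ × ℤ)) (co : ℤ × ℤ → ℂ) (r : ℝ) (k : ℤ × ℤ) :
    ℝ :=
  ∫ x, oddPow r (∑ k ∈ S, (co k * torusChar L k x).re) * (co k * torusChar L k x).re

lemma sum_mul_dualCoeff {L : ℝ} [Fact (0 < L)] (S : Finset (ℤ × ℤ)) (co : ℤ × ℤ → ℂ) {r : ℝ}
    (hr : 0 ≤ r) (m : ℤ × ℤ → ℝ) :
    ∑ k ∈ S, m k * dualCoeff L S co r k =
      ∫ x, oddPow r (∑ k ∈ S, (co k * torusChar L k x).re) *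
        ∑ k ∈ S, m k * (co k * torusChar L k x).re := by
  have hφ := continuous_oddPow hr
  have hχ := continuous_torusChar L
  simp_rw [Finset.mul_sum, dualCoeff]
  rw [integral_finsetSum]
  · refine Finset.sum_congr rfl fun k _ => ?_
    rw [← integral_const_mul]
    congr 1
    funext x
    ring
  · intro k _
    exact Continuous.integrable_of_hasCompactSupport (by fun_prop)
      (HasCompactSupport.of_compactSpace _)

lemma cosGap_dualCoeff_eq {L : ℝ} [hL : Fact (0 < L)] (S : Finset (ℤ × ℤ)) (co : ℤ × ℤ → ℂ)
    {r : ℝ} (hr : 0 ≤ r) (y : ℝ × ℝ) (s : ℝ) (hs : s ^ 2 = 1) (u : AddCircle L × AddCircle L → ℝ)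
    (hu : u = fun x => ∑ k ∈ S, (co k * torusChar L k x).re) :
    2 * ∑ k ∈ S, dualCoeff L S co r k * (1 - s * Real.cos (k.1 * y.1 + k.2 * y.2)) =
      ∫ x, (oddPow r (u (x + torusShift L y)) - s * oddPow r (u x)) *
        (u (x + torusShift L y) - s * u x) := by
  have hχ := continuous_torusChar L
  have huc : Continuous u := by rw [hu]; fun_prop
  rw [integral_oddPow_symmetrize volume hr huc (torusShift L y) s hs]
  have h1 := sum_mul_dualCoeff (L := L) S co hr (fun _ => 1)
  have h2 := sum_mul_dualCoeff (L := L) S co hr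
    (fun k => 2 * Real.cos (k.1 * y.1 + k.2 * y.2))
  simp_rw [← re_mul_torusChar_add_add_sub hL.out, Finset.sum_add_distrib] at h2
  simp only [one_mul] at h1
  subst hu
  rw [← h1, ← h2, Finset.mul_sum, Finset.mul_sum, Finset.mul_sum, ← Finset.sum_sub_distrib]
  exact Finset.sum_congr rfl fun k _ => by ring

lemma cosGap_dualCoeff {L : ℝ} [Fact (0 < L)] (S : Finset (ℤ × ℤ)) (co : ℤ × ℤ → ℂ) {r : ℝ}
    (hr : 0 ≤ r) (y : ℝ × ℝ) :
    0 ≤ cosGap S (dualCoeff L S co r) y ∧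
      cosGap S (dualCoeff L S co r) y ≤ 2 * ∑ k ∈ S, dualCoeff L S co r k := by
  have h1 := cosGap_dualCoeff_eq (L := L) S co hr y 1 (by norm_num) _ rfl
  have h2 := cosGap_dualCoeff_eq (L := L) S co hr y (-1) (by norm_num) _ rfl
  simp only [one_mul] at h1
  simp only [neg_one_mul, sub_neg_eq_add] at h2
  constructor
  · have : 0 ≤ 2 * cosGap S (dualCoeff L S co r) y := by
      rw [cosGap, h1]
      exact integral_nonneg fun x => (oddPow_sub_mul_sub hr _ _).1
    linarith
  · have h3 : 0 ≤ 2 * ∑ k ∈ S, dualCoeff L S co r k *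
        (1 + Real.cos (k.1 * y.1 + k.2 * y.2)) := by
      rw [h2]
      refine integral_nonneg fun x => ?_
      have h := (oddPow_sub_mul_sub hr
        (∑ k ∈ S, (co k * torusChar L k (x + torusShift L y)).re)
        (-∑ k ∈ S, (co k * torusChar L k x).re)).1
      rwa [oddPow_neg, sub_neg_eq_add, sub_neg_eq_add] at h
    have h4 : 2 * ∑ k ∈ S, dualCoeff L S co r k - cosGap S (dualCoeff L S co r) y =
        ∑ k ∈ S, dualCoeff L S co r k * (1 + Real.cos (k.1 * y.1 + k.2 * y.2)) := by
      rw [cosGap, Finset.mul_sum, ← Finset.sum_sub_distrib]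
      exact Finset.sum_congr rfl fun k _ => by ring
    linarith

lemma cosGap_dualCoeff_nsmul_le {L : ℝ} [Fact (0 < L)] (S : Finset (ℤ × ℤ)) (co : ℤ × ℤ → ℂ)
    {r : ℝ} (hr : 0 ≤ r) (n : ℕ) (y : ℝ × ℝ) :
    cosGap S (dualCoeff L S co r) (n • y) ≤
      8 * (r + 1) * (r / 2 + 1) ^ 2 * (n : ℝ) ^ 2 * cosGap S (dualCoeff L S co r) y := by
  have hχ := continuous_torusChar L
  have hφ := continuous_oddPow hr
  have hψ := continuous_oddPow (show 0 ≤ r / 2 by linarith)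
  have hint : ∀ {f : AddCircle L × AddCircle L → ℝ}, Continuous f → Integrable f := fun hf =>
    hf.integrable_of_hasCompactSupport (HasCompactSupport.of_compactSpace _)
  obtain ⟨u, hu⟩ : ∃ u, u = fun x : AddCircle L × AddCircle L =>
    ∑ k ∈ S, (co k * torusChar L k x).re := ⟨_, rfl⟩
  have huc : Continuous u := by rw [hu]; fun_prop
  have h1 := cosGap_dualCoeff_eq S co hr (n • y) 1 (by norm_num) u hu
  have h2 := cosGap_dualCoeff_eq S co hr y 1 (by norm_num) u hu
  simp only [one_mul] at h1 h2
  rw [torusShift_nsmul] at h1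
  set t := torusShift L y
  have e1 : 2 * cosGap S (dualCoeff L S co r) (n • y) ≤
      4 * (r + 1) * ∫ x, (oddPow (r / 2) (u (x + n • t)) - oddPow (r / 2) (u x)) ^ 2 := by
    rw [cosGap, h1, ← integral_const_mul]
    exact integral_mono (hint (by fun_prop)) (hint (by fun_prop))
      fun x => (oddPow_sub_mul_sub hr _ _).2.1
  have e2 := integral_sub_translate_nsmul_sq_le volume (hψ.comp huc) t n
  simp only [Function.comp_apply] at e2
  have e3 : ∫ x, (oddPow (r / 2) (u (x + t)) - oddPow (r / 2) (u x)) ^ 2 ≤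
      2 * (r / 2 + 1) ^ 2 * (2 * cosGap S (dualCoeff L S co r) y) := by
    rw [cosGap, h2, ← integral_const_mul]
    exact integral_mono (hint (by fun_prop)) (hint (by fun_prop))
      fun x => (oddPow_sub_mul_sub hr _ _).2.2
  have hr1 : 0 ≤ 4 * (r + 1) := by linarith
  have e4 := mul_le_mul_of_nonneg_left
    (e2.trans (mul_le_mul_of_nonneg_left e3 (sq_nonneg (n : ℝ)))) hr1
  linarith

lemma exists_le_sum_mul_knorm_rpow_of_doubling {α C : ℝ} (h0 : 0 ≤ α) (h2 : α ≤ 2) (hC : 0 < C) :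
    ∃ c : ℝ, 0 < c ∧ ∀ (S : Finset (ℤ × ℤ)) (q : ℤ × ℤ → ℝ) (N : ℕ), 0 < N →
      (∀ k ∈ S, q k ≠ 0 → (N : ℤ) ≤ |k.1| ∨ (N : ℤ) ≤ |k.2|) →
      (∀ y, 0 ≤ cosGap S q y) → (∀ y, cosGap S q y ≤ 2 * ∑ k ∈ S, q k) →
      (∀ (n : ℕ) (y : ℝ × ℝ), cosGap S q (n • y) ≤ C * (n : ℝ) ^ 2 * cosGap S q y) →
      c * (N : ℝ) ^ α * ∑ k ∈ S, q k ≤ ∑ k ∈ S, q k * knorm k ^ α := by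
  rcases h0.eq_or_lt with rfl | h0
  · exact ⟨1, one_pos, fun S q N _ _ _ _ _ => by simp⟩
  rcases h2.eq_or_lt with rfl | h2
  · simpa only [Real.rpow_two] using exists_le_sum_mul_knorm_sq hC
  · obtain ⟨c, hc, h⟩ := exists_le_sum_mul_knorm_rpow h0 h2
    exact ⟨c, hc, fun S q N hN hq g0 g2 _ => h S q N hN hq g0 g2⟩

lemma knorm_le_abs_add_abs (k : ℤ × ℤ) : knorm k ≤ |(k.1 : ℝ)| + |(k.2 : ℝ)| := by
  rw [knorm_eq_norm]
  exact Complex.norm_le_abs_re_add_abs_im _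

/-- **Lower bound for the fractional dissipation term on a Littlewood–Paley shell.**
Let `0 ≤ α ≤ 2` and `2 < l < ∞`.  There is a constant `c > 0`, depending only on `α` and `l`,
such that for every `L > 0`, every `λ ≥ 1/L`, and every real-valued trigonometric polynomial
`u = Re ∑_{k} co_k e^{2πik·x/L}` on `𝕋²` whose Fourier coefficients vanish unless
`λ ≤ 2π|k|/L ≤ 4λ`, one has
`l ∫ u (Λ^α u) |u|^{l−2} ≥ c λ^α ∫ |u|^l`,
where `Λ^α u = Re ∑_k (2π|k|/L)^α co_k e^{2πik·x/L}` is the fractional Laplacian of `u`. -/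
theorem dissipation_lower_bound (α l : ℝ) (hα0 : 0 ≤ α) (hα2 : α ≤ 2) (hl : 2 < l) :
    ∃ c : ℝ, 0 < c ∧
      ∀ (L : ℝ) [Fact (0 < L)], ∀ lam : ℝ, 1 / L ≤ lam →
        ∀ (S : Finset (ℤ × ℤ)) (co : ℤ × ℤ → ℂ),
          (∀ k ∈ S, co k ≠ 0 → lam ≤ 2 * π * knorm k / L ∧ 2 * π * knorm k / L ≤ 4 * lam) →
          l * ∫ x : AddCircle L × AddCircle L,
              (∑ k ∈ S, co k * torusChar L k x).re *
                (∑ k ∈ S, (((2 * π * knorm k / L) ^ α : ℝ) : ℂ) * co k * torusChar L k x).re *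
                |(∑ k ∈ S, co k * torusChar L k x).re| ^ (l - 2)
            ≥ c * lam ^ α *
                ∫ x : AddCircle L × AddCircle L, |(∑ k ∈ S, co k * torusChar L k x).re| ^ l := by
  obtain ⟨c, hc, hcN⟩ := exists_le_sum_mul_knorm_rpow_of_doubling hα0 hα2
    (C := 8 * (l - 1) * (l / 2) ^ 2) (by have : 0 < l - 1 := by linarith
                                         positivity)
  refine ⟨l * c * (1 / 2) ^ α, by positivity, ?_⟩
  intro L hL lam hlam S co hco
  have hL0 : 0 < L := hL.out
  have hlam0 : 0 < lam := lt_of_lt_of_le (by positivity) hlam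
  have hr : 0 ≤ l - 2 := by linarith
  set q := dualCoeff L S co (l - 2) with hq
  have hA : ∫ x : AddCircle L × AddCircle L, |(∑ k ∈ S, co k * torusChar L k x).re| ^ l =
      ∑ k ∈ S, q k := by
    have h := sum_mul_dualCoeff (L := L) S co hr (fun _ => 1)
    simp only [one_mul, ← Complex.re_sum] at h
    rw [h]
    refine integral_congr_ae (Filter.Eventually.of_forall fun x => ?_)
    simp only [oddPow]
    rw [mul_right_comm, ← abs_mul_abs_self, ← sq, ← Real.rpow_two,
      ← Real.rpow_add' (abs_nonneg _) (by linarith)]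
    congr 1
    ring
  have hD : ∫ x : AddCircle L × AddCircle L, (∑ k ∈ S, co k * torusChar L k x).re *
        (∑ k ∈ S, (((2 * π * knorm k / L) ^ α : ℝ) : ℂ) * co k * torusChar L k x).re *
        |(∑ k ∈ S, co k * torusChar L k x).re| ^ (l - 2) =
      (2 * π / L) ^ α * ∑ k ∈ S, q k * knorm k ^ α := by
    have h := sum_mul_dualCoeff (L := L) S co hr (fun k => (2 * π * knorm k / L) ^ α)
    have hre : ∀ x, ∑ k ∈ S, (2 * π * knorm k / L) ^ α * (co k * torusChar L k x).re =
        (∑ k ∈ S, (((2 * π * knorm k / L) ^ α : ℝ) : ℂ) * co k * torusChar L k x).re := by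
      intro x
      rw [Complex.re_sum]
      exact Finset.sum_congr rfl fun k _ => by rw [← Complex.re_ofReal_mul, mul_assoc (_ : ℂ)]
    simp only [hre, ← Complex.re_sum] at h
    rw [Finset.mul_sum]
    refine Eq.trans ?_ (h.symm.trans ?_)
    · refine integral_congr_ae (Filter.Eventually.of_forall fun x => ?_)
      simp only [oddPow]
      ring
    · refine Finset.sum_congr rfl fun k _ => ?_
      rw [mul_div_right_comm, Real.mul_rpow (by positivity) (show 0 ≤ knorm k from Real.sqrt_nonneg _)]
      ring
  set N := ⌈lam * L / (4 * π)⌉₊ with hN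
  have hN0 : 0 < N := Nat.ceil_pos.mpr (by positivity)
  have hqN : ∀ k ∈ S, q k ≠ 0 → (N : ℤ) ≤ |k.1| ∨ (N : ℤ) ≤ |k.2| := by
    intro k hk hqk
    have hck : co k ≠ 0 := by
      intro h
      apply hqk
      simp [hq, dualCoeff, h]
    have h1 := (hco k hk hck).1
    rw [le_div_iff₀ hL0] at h1
    have h2 := knorm_le_abs_add_abs k
    by_contra! hcon
    have hcast : ∀ m : ℤ, |m| < N → (|m| : ℝ) < lam * L / (4 * π) := by
      intro m hm
      rw [← Int.natCast_natAbs, Nat.cast_lt, hN, Nat.lt_ceil] at hm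
      simpa [← Int.cast_abs, Nat.cast_natAbs] using hm
    have h3 := add_lt_add (hcast _ hcon.1) (hcast _ hcon.2)
    have h4 := mul_lt_mul_of_pos_left (h2.trans_lt h3) (show 0 < 2 * π by positivity)
    have h5 : 2 * π * (lam * L / (4 * π) + lam * L / (4 * π)) = lam * L := by
      field_simp
      norm_num
    linarith
  have hmain := hcN S q N hN0 hqN (fun y => (cosGap_dualCoeff S co hr y).1)
    (fun y => (cosGap_dualCoeff S co hr y).2) (fun n y => by
      refine (cosGap_dualCoeff_nsmul_le S co hr n y).trans (le_of_eq ?_)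
      ring)
  rw [hA, hD, ge_iff_le]
  have hA0 : 0 ≤ ∑ k ∈ S, q k := by
    rw [← hA]
    exact integral_nonneg fun x => by positivity
  have hpow : lam ^ α * (1 / 2) ^ α ≤ (2 * π / L) ^ α * (N : ℝ) ^ α := by
    rw [← Real.mul_rpow hlam0.le (by norm_num), ← Real.mul_rpow (by positivity) (by positivity)]
    refine Real.rpow_le_rpow (by positivity) ?_ hα0
    calc lam * (1 / 2) = 2 * π / L * (lam * L / (4 * π)) := by field_simp; norm_num
      _ ≤ 2 * π / L * N := by gcongr; exact Nat.le_ceil _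
  calc l * c * (1 / 2) ^ α * lam ^ α * ∑ k ∈ S, q k
      = l * c * (lam ^ α * (1 / 2) ^ α) * ∑ k ∈ S, q k := by ring
    _ ≤ l * c * ((2 * π / L) ^ α * (N : ℝ) ^ α) * ∑ k ∈ S, q k := by gcongr
    _ = l * ((2 * π / L) ^ α * (c * (N : ℝ) ^ α * ∑ k ∈ S, q k)) := by ring
    _ ≤ l * ((2 * π / L) ^ α * ∑ k ∈ S, q k * knorm k ^ α) := by gcongr
end
end

section
/- Quantitative De Giorgi iteration: let α > 0, C > 0, and p' ≥ 1 be such that δ := (2 − 2p' + p'α)/(2p') > 0. Then there exist constants c₁, c₂ > 0 depending only on α, p', and C with the following property: for all ν > 0, t₀ > 0, F ≥ 0, U₀ > 0, and all M > 0 satisfying M ≥ c₁ U₀^{1/2} (ν t₀)^{−1/α} + c₂ (F/ν)^{p'/(2 + p'(α−1))} U₀^{p'δ/(2 + p'(α−1))}, every sequence (U_k)_{k≥0} of nonnegative reals starting from U₀ and satisfying U_k ≤ C 2^{2kα+1} (ν t₀ M^α)^{−1} U_{k−1}^{1+α/2} + C F 2^{k(2/p' + α − 1)} (ν M^{2/p'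 + α − 1})^{−1} U_{k−1}^{1+δ} for all k ≥ 1 converges to 0 as k → ∞. -/
/-- A superlinear term with geometrically growing coefficients preserves geometric decay,
provided the initial size is small. -/
lemma superlinear_term_le_geometric {A a q σ u V : ℝ} (hA : 0 ≤ A) (ha : 0 ≤ a) (hq : 0 ≤ q)
    (hσ : 0 ≤ σ) (hu : 0 ≤ u) (hV : 0 < V) (k : ℕ) (huV : u ≤ V * q ^ k)
    (hsmall : A * a * V ^ σ ≤ q / 2) (haq : a * q ^ σ ≤ 1) :
    A * a ^ (k + 1) * u ^ (1 + σ) ≤ V * q ^ (k + 1) / 2 := by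
  have hVq : 0 ≤ V * q ^ k := by positivity
  calc A * a ^ (k + 1) * u ^ (1 + σ)
      ≤ A * a ^ (k + 1) * (V * q ^ k) ^ (1 + σ) := by gcongr
    _ = V * q ^ k * (A * a * V ^ σ) * (a * q ^ σ) ^ k := by
        rw [Real.rpow_add_of_nonneg hVq zero_le_one hσ, Real.rpow_one,
          Real.mul_rpow hV.le (by positivity), ← Real.rpow_pow_comm hq, mul_pow]
        ring
    _ ≤ V * q ^ k * (q / 2) * 1 := by
        gcongr
        exact pow_le_one₀ (by positivity) haq
    _ = V * q ^ (k + 1) / 2 := by ring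

/-- A nonnegative sequence obeying a two-term superlinear recursion with geometrically growing
coefficients tends to zero if its initial value is small enough. -/
lemma tendsto_zero_of_superlinear_recursion {A B a b q σ τ : ℝ} {U : ℕ → ℝ}
    (hA : 0 ≤ A) (hB : 0 ≤ B) (ha : 0 ≤ a) (hb : 0 ≤ b) (hq : 0 ≤ q) (hq_lt : q < 1)
    (hσ : 0 ≤ σ) (hτ : 0 ≤ τ) (hU : ∀ k, 0 ≤ U k) (hU_zero : 0 < U 0)
    (haq : a * q ^ σ ≤ 1) (hbq : b * q ^ τ ≤ 1)
    (hA_small : A * a * U 0 ^ σ ≤ q / 2) (hB_small : B * b * U 0 ^ τ ≤ q / 2)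
    (hrec : ∀ k, U (k + 1) ≤
      A * a ^ (k + 1) * U k ^ (1 + σ) + B * b ^ (k + 1) * U k ^ (1 + τ)) :
    Filter.Tendsto U Filter.atTop (nhds 0) := by
  have hdecay : ∀ k, U k ≤ U 0 * q ^ k := by
    intro k
    induction k with
    | zero => simp
    | succ k ih =>
      linarith [hrec k,
        superlinear_term_le_geometric hA ha hq hσ (hU k) hU_zero k ih hA_small haq,
        superlinear_term_le_geometric hB hb hq hτ (hU k) hU_zero k ih hB_small hbq]
  refine squeeze_zero hU hdecay ?_
  simpa using (tendsto_pow_atTop_nhds_zero_of_lt_one hq hq_lt).const_mul (U 0)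

/-- A lower bound by a product of `s`-th roots, raised to the power `s`. -/
lemma mul_mul_le_rpow_of_root_le {K X Y M s e : ℝ} (hK : 0 ≤ K) (hX : 0 ≤ X) (hY : 0 ≤ Y)
    (hs : 0 < s) (h : K ^ (1 / s) * X ^ (1 / s) * Y ^ (e / s) ≤ M) :
    K * X * Y ^ e ≤ M ^ s := by
  have hpow := Real.rpow_le_rpow (by positivity) h hs.le
  rwa [Real.mul_rpow (by positivity) (by positivity), Real.mul_rpow (by positivity) (by positivity),
    ← Real.rpow_mul hK, ← Real.rpow_mul hX, ← Real.rpow_mul hY, div_mul_cancel₀ _ hs.ne',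
    div_mul_cancel₀ _ hs.ne', Real.rpow_one, Real.rpow_one] at hpow

/-- **Quantitative De Giorgi iteration.**  Let `α > 0`, `C > 0`, `p' ≥ 1` with
`δ := (2 − 2p' + p'α)/(2p') > 0`.  Then there exist `c₁, c₂ > 0` depending only on
`α, p', C` such that: for all `ν > 0`, `t₀ > 0`, `F ≥ 0`, `U₀ > 0` and all `M > 0` with
`M ≥ c₁ U₀^{1/2} (νt₀)^{−1/α} + c₂ (F/ν)^{p'/(2+p'(α−1))} U₀^{p'δ/(2+p'(α−1))}`,
every sequence `(U_k)` of nonnegative reals starting from `U₀` and satisfying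
`U_k ≤ C 2^{2kα+1} (νt₀M^α)⁻¹ U_{k−1}^{1+α/2} + C F 2^{k(2/p'+α−1)} (νM^{2/p'+α−1})⁻¹ U_{k−1}^{1+δ}`
for all `k ≥ 1` converges to `0`. -/
theorem de_giorgi_iteration_quantitative (α C p' δ : ℝ) (hα : 0 < α) (hC : 0 < C)
    (hp' : 1 ≤ p') (hδdef : δ = (2 - 2 * p' + p' * α) / (2 * p')) (hδ : 0 < δ) :
    ∃ c₁ c₂ : ℝ, 0 < c₁ ∧ 0 < c₂ ∧
      ∀ ν t₀ F U₀ M : ℝ, 0 < ν → 0 < t₀ → 0 ≤ F → 0 < U₀ → 0 < M →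
        c₁ * U₀ ^ (1 / 2 : ℝ) * (ν * t₀) ^ (-(1 / α)) +
            c₂ * (F / ν) ^ (p' / (2 + p' * (α - 1))) * U₀ ^ (p' * δ / (2 + p' * (α - 1))) ≤ M →
        ∀ U : ℕ → ℝ, (∀ k, 0 ≤ U k) → U 0 = U₀ →
          (∀ k : ℕ, U (k + 1) ≤
              C * 2 ^ (2 * ((k : ℝ) + 1) * α + 1) * (ν * t₀ * M ^ α)⁻¹ * U k ^ (1 + α / 2) +
              C * F * 2 ^ (((k : ℝ) + 1) * (2 / p' + α - 1)) *
                (ν * M ^ (2 / p' + α - 1))⁻¹ * U k ^ (1 + δ)) →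
          Filter.Tendsto U Filter.atTop (nhds 0) := by
  have hp : 0 < p' := by linarith
  set β : ℝ := 2 / p' + α - 1 with hβ_def
  have hβδ : β = 2 * δ + 1 := by
    rw [hβ_def, hδdef]
    field_simp
    ring
  have hβ : 0 < β := by linarith
  have hden : 2 + p' * (α - 1) = p' * β := by
    rw [hβ_def]
    field_simp
    ring
  have hexp₁ : p' / (2 + p' * (α - 1)) = 1 / β := by
    rw [hden]
    field_simp
  have hexp₂ : p' * δ / (2 + p' * (α - 1)) = δ / β := by
    rw [hden]
    field_simp
  rw [hexp₁, hexp₂]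
  set r : ℝ := 4 + β / δ with hr_def
  have hβδ_pos : 0 < β / δ := by positivity
  set q : ℝ := 2 ^ (-r) with hq_def
  have hq : 0 < q := by positivity
  have hq_lt : q < 1 := Real.rpow_lt_one_of_one_lt_of_neg one_lt_two (by linarith)
  set a : ℝ := 2 ^ (2 * α) with ha_def
  set b : ℝ := 2 ^ β with hb_def
  have ha : 0 < a := by positivity
  have hb : 0 < b := by positivity
  have haq : a * q ^ (α / 2) ≤ 1 := by
    rw [ha_def, hq_def, ← Real.rpow_mul zero_le_two, ← Real.rpow_add two_pos]
    refine Real.rpow_le_one_of_one_le_of_nonpos one_le_two ?_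
    rw [hr_def]
    nlinarith
  have hbq : b * q ^ δ ≤ 1 := by
    rw [hb_def, hq_def, ← Real.rpow_mul zero_le_two, ← Real.rpow_add two_pos]
    refine Real.rpow_le_one_of_one_le_of_nonpos one_le_two ?_
    have hcancel : β / δ * δ = β := div_mul_cancel₀ _ hδ.ne'
    rw [hr_def]
    nlinarith
  refine ⟨(4 * C * a / q) ^ (1 / α), (2 * C * b / q) ^ (1 / β), by positivity, by positivity, ?_⟩
  intro ν t₀ F U₀ M hν ht₀ hF hU₀ hM hM_le U hU hU_zero hrec
  have hνt : 0 < ν * t₀ := by positivity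
  have hroot₁ : (4 * C * a / q) ^ (1 / α) * ((ν * t₀)⁻¹) ^ (1 / α) * U₀ ^ (α / 2 / α) ≤ M := by
    rw [Real.inv_rpow hνt.le, ← Real.rpow_neg hνt.le,
      show α / 2 / α = 1 / 2 by field_simp, mul_right_comm]
    exact (le_add_of_nonneg_right (by positivity)).trans hM_le
  have hroot₂ : (2 * C * b / q) ^ (1 / β) * (F / ν) ^ (1 / β) * U₀ ^ (δ / β) ≤ M :=
    (le_add_of_nonneg_left (by positivity)).trans hM_le
  have hM₁ := mul_mul_le_rpow_of_root_le (by positivity) (by positivity) hU₀.le hα hroot₁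
  have hM₂ := mul_mul_le_rpow_of_root_le (by positivity) (by positivity) hU₀.le hβ hroot₂
  have hMα : 0 < M ^ α := by positivity
  have hMβ : 0 < M ^ β := by positivity
  refine tendsto_zero_of_superlinear_recursion (A := 2 * C * (ν * t₀ * M ^ α)⁻¹)
    (B := C * F * (ν * M ^ β)⁻¹) (by positivity) (by positivity) ha.le hb.le hq.le hq_lt
    (half_pos hα).le hδ.le hU (hU_zero ▸ hU₀) haq hbq ?_ ?_ ?_
  · rw [hU_zero]
    calc 2 * C * (ν * t₀ * M ^ α)⁻¹ * a * U₀ ^ (α / 2)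
        = q / 2 * (4 * C * a / q * (ν * t₀)⁻¹ * U₀ ^ (α / 2)) / M ^ α := by
          field_simp
          ring
      _ ≤ q / 2 * M ^ α / M ^ α := by gcongr
      _ = q / 2 := mul_div_cancel_right₀ _ hMα.ne'
  · rw [hU_zero]
    calc C * F * (ν * M ^ β)⁻¹ * b * U₀ ^ δ
        = q / 2 * (2 * C * b / q * (F / ν) * U₀ ^ δ) / M ^ β := by
          field_simp
      _ ≤ q / 2 * M ^ β / M ^ β := by gcongr
      _ = q / 2 := mul_div_cancel_right₀ _ hMβ.ne'
  · intro k
    have hpow₁ : (2 : ℝ) ^ (2 * ((k : ℝ) + 1) * α + 1) = a ^ (k + 1) * 2 := by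
      rw [Real.rpow_add_one two_ne_zero, ha_def, ← Real.rpow_mul_natCast zero_le_two]
      push_cast
      ring_nf
    have hpow₂ : (2 : ℝ) ^ (((k : ℝ) + 1) * β) = b ^ (k + 1) := by
      rw [hb_def, ← Real.rpow_mul_natCast zero_le_two]
      push_cast
      ring_nf
    have hk := hrec k
    rw [hpow₁, hpow₂] at hk
    convert hk using 2 <;> ring
end
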